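/- For every integer n ≥ 1, M_{2n−1} = M̄_n. -/

import Mathlib

open Filter

/-- `x` lies strictly between `p` and `q`. -/
def StrictlyBetween (p q x : ℕ) : Prop := min p q < x ∧ x < max p q

/-- Two arcs `{p, q}` and `{r, s}` cross if exactly one of `r`, `s` lies strictly
between `p` and `q`. -/
def ArcsCross (p q r s : ℕ) : Prop :=
  Xor' (StrictlyBetween p q r) (StrictlyBetween p q s)

/-- `a` (with one-based indexing, only the values `a 1, …, a n` being relevant)
is an open meandric permutation of order `n`: it is a permutation of `{1, …, n}`
with `a i ≡ i (mod 2)`, whose upper arcs (pairs `{a i, a (i+1)}` for odd `i < n`)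
are pairwise noncrossing, whose lower arcs (pairs `{a i, a (i+1)}` for even
`1 ≤ i < n`) are pairwise noncrossing, such that no lower arc strictly encloses
`a 1`, and no lower arc (if `n` is even) resp. upper arc (if `n` is odd)
strictly encloses `a n`. -/
def IsOpenMeandricPerm (n : ℕ) (a : ℕ → ℕ) : Prop :=
  1 ≤ n ∧
  (∀ i, 1 ≤ i → i ≤ n → 1 ≤ a i ∧ a i ≤ n) ∧
  (∀ i j, 1 ≤ i → i ≤ n → 1 ≤ j → j ≤ n → a i = a j → i = j) ∧
  (∀ i, 1 ≤ i → i ≤ n → a i % 2 = i % 2) ∧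
  (∀ i j, Odd i → i < n → Odd j → j < n →
      ¬ ArcsCross (a i) (a (i + 1)) (a j) (a (j + 1))) ∧
  (∀ i j, Even i → 1 ≤ i → i < n → Even j → 1 ≤ j → j < n →
      ¬ ArcsCross (a i) (a (i + 1)) (a j) (a (j + 1))) ∧
  (∀ i, Even i → 1 ≤ i → i < n → ¬ StrictlyBetween (a i) (a (i + 1)) (a 1)) ∧
  (if Even n
    then ∀ i, Even i → 1 ≤ i → i < n → ¬ StrictlyBetween (a i) (a (i + 1)) (a n)
    else ∀ i, Odd i → i < n → ¬ StrictlyBetween (a i) (a (i + 1)) (a n))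

/-- An open meandric permutation of order `n` is irreducible if there are no
indices `1 ≤ k₁ < k₂ ≤ n` with `2 < k₂ - k₁ ≤ n - 2` such that the values
`a k₁, …, a k₂` form an interval of integers, i.e. their max minus their min
equals `k₂ - k₁`. -/
def IsIrreducibleMeander (n : ℕ) (a : ℕ → ℕ) : Prop :=
  ¬ ∃ k₁ k₂ : ℕ, ∃ h : k₁ < k₂, 1 ≤ k₁ ∧ k₂ ≤ n ∧ 2 < k₂ - k₁ ∧ k₂ - k₁ ≤ n - 2 ∧
    (Finset.Icc k₁ k₂).sup' (Finset.nonempty_Icc.mpr h.le) a -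
      (Finset.Icc k₁ k₂).inf' (Finset.nonempty_Icc.mpr h.le) a = k₂ - k₁

/-- An open meandric permutation of order `n` is prime if `a 1 ≠ 1` and no proper
initial segment `a 1, …, a j` (`2 ≤ j < n`) is a permutation of `{1, …, j}`. -/
def IsPrimeMeander (n : ℕ) (a : ℕ → ℕ) : Prop :=
  a 1 ≠ 1 ∧ ¬ ∃ j, 2 ≤ j ∧ j < n ∧ (Finset.Icc 1 j).image a = Finset.Icc 1 j

/-- `a` (with one-based indexing) is a closed meandric permutation of order `n`:
a permutation of `{1, …, 2n}` with `a 1 = 1`, `a i ≡ i (mod 2)`, pairwise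
noncrossing upper arcs `{a i, a (i+1)}` (odd `i < 2n`) and pairwise noncrossing
lower arcs, the latter being the `{a i, a (i+1)}` for even `1 ≤ i < 2n` together
with the wrap-around arc `{a (2n), a 1}`. -/
def IsClosedMeandricPerm (n : ℕ) (a : ℕ → ℕ) : Prop :=
  1 ≤ n ∧ a 1 = 1 ∧
  (∀ i, 1 ≤ i → i ≤ 2 * n → 1 ≤ a i ∧ a i ≤ 2 * n) ∧
  (∀ i j, 1 ≤ i → i ≤ 2 * n → 1 ≤ j → j ≤ 2 * n → a i = a j → i = j) ∧
  (∀ i, 1 ≤ i → i ≤ 2 * n → a i % 2 = i % 2) ∧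
  (∀ i j, Odd i → i < 2 * n → Odd j → j < 2 * n →
      ¬ ArcsCross (a i) (a (i + 1)) (a j) (a (j + 1))) ∧
  (∀ i j, Even i → 1 ≤ i → i < 2 * n → Even j → 1 ≤ j → j < 2 * n →
      ¬ ArcsCross (a i) (a (i + 1)) (a j) (a (j + 1))) ∧
  (∀ i, Even i → 1 ≤ i → i < 2 * n →
      ¬ ArcsCross (a i) (a (i + 1)) (a (2 * n)) (a 1) ∧
      ¬ ArcsCross (a (2 * n)) (a 1) (a i) (a (i + 1)))

/-- `M n`: the number of open meandric permutations of order `n` (each counted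
once via the normalization `a i = 0` outside `{1, …, n}`). -/
noncomputable def openMeanderCount (n : ℕ) : ℕ :=
  Set.ncard {a : ℕ → ℕ | IsOpenMeandricPerm n a ∧ ∀ i, i < 1 ∨ n < i → a i = 0}

/-- `M^{Irr} n`: the number of irreducible open meandric permutations of order `n`. -/
noncomputable def irrMeanderCount (n : ℕ) : ℕ :=
  Set.ncard {a : ℕ → ℕ | IsOpenMeandricPerm n a ∧ IsIrreducibleMeander n a ∧
    ∀ i, i < 1 ∨ n < i → a i = 0}

/-- `M^{(P)} n`: the number of prime open meandric permutations of order `n`. -/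
noncomputable def primeMeanderCount (n : ℕ) : ℕ :=
  Set.ncard {a : ℕ → ℕ | IsOpenMeandricPerm n a ∧ IsPrimeMeander n a ∧
    ∀ i, i < 1 ∨ n < i → a i = 0}

/-- `M̄ n`: the number of closed meandric permutations of order `n`. -/
noncomputable def closedMeanderCount (n : ℕ) : ℕ :=
  Set.ncard {a : ℕ → ℕ | IsClosedMeandricPerm n a ∧ ∀ i, i < 1 ∨ 2 * n < i → a i = 0}

theorem strictlyBetween_iff {p q x : ℕ} :
    StrictlyBetween p q x ↔ p < x ∧ x < q ∨ q < x ∧ x < p := by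
  unfold StrictlyBetween
  omega

theorem arcsCross_iff {p q r s : ℕ} :
    ArcsCross p q r s ↔ StrictlyBetween p q r ∧ ¬ StrictlyBetween p q s ∨
      StrictlyBetween p q s ∧ ¬ StrictlyBetween p q r :=
  Iff.rfl

theorem not_arcsCross_self (p q : ℕ) : ¬ ArcsCross p q p q := by
  simp only [arcsCross_iff, strictlyBetween_iff]
  omega

/-- A `2n`-periodic two-sided sequence tracing a closed meander with `2n` crossings. -/
structure IsCyclicMeander (n : ℕ) (f : ℤ → ℕ) : Prop where
  periodic : Function.Periodic f (2 * n)
  pos : ∀ i, 1 ≤ f i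
  le : ∀ i, f i ≤ 2 * n
  dvd_sub : ∀ i j, f i = f j → (2 * n : ℤ) ∣ i - j
  parity : ∀ i, (f i : ℤ) % 2 = i % 2
  upper : ∀ i j, Odd i → Odd j → ¬ ArcsCross (f i) (f (i + 1)) (f j) (f (j + 1))
  lower : ∀ i j, Even i → Even j → ¬ ArcsCross (f i) (f (i + 1)) (f j) (f (j + 1))

namespace IsCyclicMeander

variable {n : ℕ} {f : ℤ → ℕ}

theorem eq_of_dvd (hf : IsCyclicMeander n f) {i j : ℤ} (h : (2 * n : ℤ) ∣ i - j) :
    f i = f j := by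
  obtain ⟨m, hm⟩ := h
  have := hf.periodic.int_mul m j
  rw [← this]
  congr 1
  rw [Int.cast_id]
  linarith

theorem eq_of_apply_eq (hf : IsCyclicMeander n f) {i j : ℤ} (h : f i = f j)
    (hij : i - j < 2 * n) (hji : j - i < 2 * n) : i = j :=
  sub_eq_zero.1 (Int.eq_zero_of_abs_lt_dvd (hf.dvd_sub _ _ h) (abs_lt.2 ⟨by omega, hij⟩))

/-- Rotating a cyclic meander by an even amount gives a cyclic meander. -/
theorem shift (hf : IsCyclicMeander n f) {s : ℤ} (hs : Even s) :
    IsCyclicMeander n (fun i => f (i + s)) where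
  periodic i := by
    simpa only [add_right_comm] using hf.periodic (i + s)
  pos _ := hf.pos _
  le _ := hf.le _
  dvd_sub i j h := by simpa using hf.dvd_sub _ _ h
  parity i := by
    rw [hf.parity]
    obtain ⟨t, rfl⟩ := hs
    omega
  upper i j hi hj := by
    have := hf.upper (i + s) (j + s) (hi.add_even hs) (hj.add_even hs)
    simpa only [add_right_comm] using this
  lower i j hi hj := by
    have := hf.lower (i + s) (j + s) (hi.add hs) (hj.add hs)
    simpa only [add_right_comm] using this

theorem exists_eq (hf : IsCyclicMeander n f) {x : ℕ} (h1 : 1 ≤ x) (h2 : x ≤ 2 * n) :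
    ∃ i, f i = x := by
  have hmaps : Set.MapsTo (fun i : ℕ => f i) (Finset.Icc 1 (2 * n)) (Finset.Icc 1 (2 * n)) :=
    fun i _ => by simpa using ⟨hf.pos i, hf.le i⟩
  have hinj : Set.InjOn (fun i : ℕ => f i) (Finset.Icc 1 (2 * n) : Finset ℕ) := by
    intro i hi j hj h
    simp only [Finset.coe_Icc, Set.mem_Icc] at hi hj
    have := hf.eq_of_apply_eq h (by omega) (by omega)
    omega
  obtain ⟨i, -, hi⟩ := Finset.surjOn_of_injOn_of_card_le _ hmaps hinj le_rfl
    (show x ∈ ((Finset.Icc 1 (2 * n) : Finset ℕ) : Set ℕ) by simpa using ⟨h1, h2⟩)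
  exact ⟨i, hi⟩

end IsCyclicMeander

/-- The number of cyclic meanders taking a prescribed value at a prescribed index does not
depend on the choice of value and index. -/
theorem ncard_isCyclicMeander_eq {n x y : ℕ} {u v : ℤ} (hx : 1 ≤ x) (hxn : x ≤ 2 * n)
    (hy : 1 ≤ y) (hyn : y ≤ 2 * n) (hxu : (x : ℤ) % 2 = u % 2) (hyv : (y : ℤ) % 2 = v % 2) :
    {f | IsCyclicMeander n f ∧ f u = x}.ncard = {f | IsCyclicMeander n f ∧ f v = y}.ncard := by
  have hex : ∀ f, IsCyclicMeander n f → ∃ p, f p = y := fun f hf => hf.exists_eq hy hyn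
  choose p hp using hex
  have heven : ∀ f hf, Even (p f hf - v) := fun f hf => by
    have h1 := hf.parity (p f hf)
    rw [hp f hf] at h1
    rw [Int.even_iff]
    omega
  refine Set.ncard_congr (fun f hf i => f (i + (p f hf.1 - v))) ?_ ?_ ?_
  · rintro f ⟨hf, -⟩
    refine ⟨hf.shift (heven f hf), ?_⟩
    simpa using hp f hf
  · rintro f g ⟨hf, hfu⟩ ⟨hg, hgu⟩ h
    have key : ∀ i, f i = g (i + (p g hg - p f hf)) := fun i => by
      have := congrFun h (i - (p f hf - v))
      simp only [sub_add_cancel] at this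
      rw [this]
      congr 1
      ring
    have hd := hg.dvd_sub _ _ ((key u).symm.trans (hfu.trans hgu.symm))
    funext i
    rw [key i]
    exact hg.eq_of_dvd (by simpa using hd)
  · rintro g ⟨hg, hgv⟩
    obtain ⟨q, hq⟩ := hg.exists_eq hx hxn
    have hqe : Even (q - u) := by
      have := hg.parity q
      rw [hq] at this
      rw [Int.even_iff]
      omega
    have hf := hg.shift hqe
    refine ⟨_, ⟨hf, by simpa using hq⟩, ?_⟩
    have hd := hg.dvd_sub _ _ ((hp _ hf).trans hgv.symm)
    funext i
    refine hg.eq_of_dvd ?_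
    convert hd using 1
    ring

/-- The `2n`-periodic extension of the finite sequence `b 1, …, b (2n)`. -/
def periodicExtension (n : ℕ) (b : ℕ → ℕ) (i : ℤ) : ℕ :=
  b (((i - 1) % (2 * n)).toNat + 1)

theorem periodicExtension_add_mul {n : ℕ} (b : ℕ → ℕ) {k : ℕ} (h1 : 1 ≤ k) (h2 : k ≤ 2 * n)
    (m : ℤ) : periodicExtension n b (k + 2 * n * m) = b k := by
  unfold periodicExtension
  have : ((k : ℤ) + 2 * n * m - 1) % (2 * n) = k - 1 := by
    rw [show (k : ℤ) + 2 * n * m - 1 = (k - 1) + 2 * n * m by ring, Int.add_mul_emod_self_left]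
    exact Int.emod_eq_of_lt (by omega) (by omega)
  rw [this]
  congr 1
  omega

theorem periodicExtension_natCast {n : ℕ} (b : ℕ → ℕ) {k : ℕ} (h1 : 1 ≤ k) (h2 : k ≤ 2 * n) :
    periodicExtension n b k = b k := by
  simpa using periodicExtension_add_mul b h1 h2 0

theorem periodicExtension_periodic (n : ℕ) (b : ℕ → ℕ) :
    Function.Periodic (periodicExtension n b) (2 * n) := by
  intro i
  unfold periodicExtension
  rw [show i + 2 * (n : ℤ) - 1 = (i - 1) + 2 * n by ring, Int.add_emod_right]

theorem exists_eq_add_mul {n : ℕ} (hn : 1 ≤ n) (i : ℤ) :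
    ∃ k : ℕ, ∃ m : ℤ, 1 ≤ k ∧ k ≤ 2 * n ∧ i = k + 2 * n * m := by
  have h0 := Int.emod_nonneg (i - 1) (show (2 * n : ℤ) ≠ 0 by omega)
  have h1 := Int.emod_lt_of_pos (i - 1) (show (0 : ℤ) < 2 * n by omega)
  have h2 := Int.emod_add_mul_ediv (i - 1) (2 * n)
  refine ⟨((i - 1) % (2 * n)).toNat + 1, (i - 1) / (2 * n), by omega, by omega, ?_⟩
  push_cast
  rw [Int.toNat_of_nonneg h0]
  linarith

theorem IsCyclicMeander.eq_periodicExtension {n : ℕ} {f : ℤ → ℕ} (hf : IsCyclicMeander n f)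
    (hn : 1 ≤ n) {b : ℕ → ℕ} (h : ∀ k : ℕ, 1 ≤ k → k ≤ 2 * n → b k = f k) :
    periodicExtension n b = f := by
  funext i
  obtain ⟨k, m, h1, h2, rfl⟩ := exists_eq_add_mul hn i
  rw [periodicExtension_add_mul b h1 h2, h k h1 h2]
  exact hf.eq_of_dvd ⟨-m, by ring⟩

theorem isCyclicMeander_periodicExtension {n : ℕ} (hn : 1 ≤ n) {b : ℕ → ℕ}
    (hrange : ∀ i, 1 ≤ i → i ≤ 2 * n → 1 ≤ b i ∧ b i ≤ 2 * n)
    (hinj : ∀ i j, 1 ≤ i → i ≤ 2 * n → 1 ≤ j → j ≤ 2 * n → b i = b j → i = j)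
    (hpar : ∀ i, 1 ≤ i → i ≤ 2 * n → b i % 2 = i % 2)
    (hup : ∀ i j, Odd i → i < 2 * n → Odd j → j < 2 * n →
      ¬ ArcsCross (b i) (b (i + 1)) (b j) (b (j + 1)))
    (hlow : ∀ i j, Even i → 1 ≤ i → i < 2 * n → Even j → 1 ≤ j → j < 2 * n →
      ¬ ArcsCross (b i) (b (i + 1)) (b j) (b (j + 1)))
    (hwrap : ∀ i, Even i → 1 ≤ i → i < 2 * n →
      ¬ ArcsCross (b i) (b (i + 1)) (b (2 * n)) (b 1) ∧
      ¬ ArcsCross (b (2 * n)) (b 1) (b i) (b (i + 1))) :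
    IsCyclicMeander n (periodicExtension n b) := by
  have hnext : ∀ (k : ℕ) (m : ℤ), 1 ≤ k → k < 2 * n →
      periodicExtension n b (k + 2 * n * m + 1) = b (k + 1) := fun k m h1 h2 => by
    rw [← periodicExtension_add_mul b (Nat.le_add_left 1 k) h2 m]
    congr 1
    push_cast
    ring
  have hlast : ∀ m : ℤ, periodicExtension n b ((2 * n : ℕ) + 2 * n * m + 1) = b 1 := fun m => by
    rw [← periodicExtension_add_mul (n := n) b le_rfl (by omega) (m + 1)]
    congr 1
    push_cast
    ring
  have hparity : ∀ (k : ℕ) (m : ℤ), ((k : ℤ) + 2 * n * m) % 2 = (k % 2 : ℕ) := fun k m => by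
    rw [mul_assoc, Int.add_mul_emod_self_left]
    simp
  refine ⟨periodicExtension_periodic n b, fun i => ?_, fun i => ?_, fun i j h => ?_, fun i => ?_,
    fun i j hi hj => ?_, fun i j hi hj => ?_⟩ <;>
    obtain ⟨k, m, hk1, hk2, rfl⟩ := exists_eq_add_mul hn i
  · rw [periodicExtension_add_mul b hk1 hk2]
    exact (hrange k hk1 hk2).1
  · rw [periodicExtension_add_mul b hk1 hk2]
    exact (hrange k hk1 hk2).2
  · obtain ⟨l, m', hl1, hl2, rfl⟩ := exists_eq_add_mul hn j
    rw [periodicExtension_add_mul b hk1 hk2, periodicExtension_add_mul b hl1 hl2] at h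
    rw [hinj k l hk1 hk2 hl1 hl2 h]
    exact ⟨m - m', by ring⟩
  · rw [periodicExtension_add_mul b hk1 hk2, hparity, ← hpar k hk1 hk2]
    simp
  · obtain ⟨l, m', hl1, hl2, rfl⟩ := exists_eq_add_mul hn j
    have hko : Odd k := by
      rw [Int.odd_iff, hparity] at hi
      rw [Nat.odd_iff]
      exact_mod_cast hi
    have hlo : Odd l := by
      rw [Int.odd_iff, hparity] at hj
      rw [Nat.odd_iff]
      exact_mod_cast hj
    have hk : k < 2 * n := by obtain ⟨t, rfl⟩ := hko; omega
    have hl : l < 2 * n := by obtain ⟨t, rfl⟩ := hlo; omega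
    rw [periodicExtension_add_mul b hk1 hk2, periodicExtension_add_mul b hl1 hl2,
      hnext k m hk1 hk, hnext l m' hl1 hl]
    exact hup k l hko hk hlo hl
  · obtain ⟨l, m', hl1, hl2, rfl⟩ := exists_eq_add_mul hn j
    have hke : Even k := by
      rw [Int.even_iff, hparity] at hi
      rw [Nat.even_iff]
      exact_mod_cast hi
    have hle : Even l := by
      rw [Int.even_iff, hparity] at hj
      rw [Nat.even_iff]
      exact_mod_cast hj
    rw [periodicExtension_add_mul b hk1 hk2, periodicExtension_add_mul b hl1 hl2]
    rcases hk2.lt_or_eq with hk | rfl <;> rcases hl2.lt_or_eq with hl | rfl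
    · rw [hnext k m hk1 hk, hnext l m' hl1 hl]
      exact hlow k l hke hk1 hk hle hl1 hl
    · rw [hnext k m hk1 hk, hlast]
      exact (hwrap k hke hk1 hk).1
    · rw [hlast, hnext l m' hl1 hl]
      exact (hwrap l hle hl1 hl).2
    · rw [hlast, hlast]
      exact not_arcsCross_self _ _

theorem IsClosedMeandricPerm.isCyclicMeander {n : ℕ} {a : ℕ → ℕ}
    (ha : IsClosedMeandricPerm n a) : IsCyclicMeander n (periodicExtension n a) := by
  obtain ⟨hn, -, hrange, hinj, hpar, hup, hlow, hwrap⟩ := ha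
  exact isCyclicMeander_periodicExtension hn hrange hinj hpar hup hlow hwrap

theorem IsCyclicMeander.isClosedMeandricPerm {n : ℕ} {f : ℤ → ℕ} (hf : IsCyclicMeander n f)
    (hn : 1 ≤ n) (h1 : f 1 = 1) {a : ℕ → ℕ} (ha : ∀ k : ℕ, 1 ≤ k → k ≤ 2 * n → a k = f k) :
    IsClosedMeandricPerm n a := by
  have hs : ∀ k : ℕ, k < 2 * n → a (k + 1) = f (k + 1) := fun k hk => by
    rw [ha (k + 1) (by omega) (by omega)]
    push_cast
    rfl
  have hlast : a (2 * n) = f (2 * n : ℕ) := ha _ (by omega) le_rfl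
  have hfirst : a 1 = f ((2 * n : ℕ) + 1) := by
    rw [ha 1 le_rfl (by omega)]
    exact hf.eq_of_dvd ⟨-1, by push_cast; ring⟩
  refine ⟨hn, ?_, fun i hi hi' => ?_, fun i j hi hi' hj hj' h => ?_, fun i hi hi' => ?_,
    fun i j hi hi' hj hj' => ?_, fun i j hi hi1 hi' hj hj1 hj' => ?_, fun i hi hi1 hi' => ?_⟩
  · rw [ha 1 le_rfl (by omega)]
    exact_mod_cast h1
  · rw [ha i hi hi']
    exact ⟨hf.pos _, hf.le _⟩
  · rw [ha i hi hi', ha j hj hj'] at h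
    have := hf.eq_of_apply_eq h (by omega) (by omega)
    omega
  · have := hf.parity i
    rw [ha i hi hi']
    omega
  · rw [ha i hi.pos hi'.le, ha j hj.pos hj'.le, hs i hi', hs j hj']
    exact hf.upper _ _ (by exact_mod_cast hi) (by exact_mod_cast hj)
  · rw [ha i hi1 hi'.le, ha j hj1 hj'.le, hs i hi', hs j hj']
    exact hf.lower _ _ (by exact_mod_cast hi) (by exact_mod_cast hj)
  · rw [ha i hi1 hi'.le, hs i hi', hlast, hfirst]
    exact ⟨hf.lower _ _ (by exact_mod_cast hi) (by simp),
      hf.lower _ _ (by simp) (by exact_mod_cast hi)⟩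

/-- Joining the two ends of an open meander of odd order through a new rightmost crossing. -/
theorem IsOpenMeandricPerm.isCyclicMeander {n : ℕ} (hn : 1 ≤ n) {a : ℕ → ℕ}
    (ha : IsOpenMeandricPerm (2 * n - 1) a) :
    IsCyclicMeander n (periodicExtension n (Function.update a (2 * n) (2 * n))) := by
  obtain ⟨-, hrange, hinj, hpar, hup, hlow, hstart, hend⟩ := ha
  rw [if_neg (by rw [Nat.even_iff]; omega)] at hend
  set b := Function.update a (2 * n) (2 * n) with hb
  have hlast : b (2 * n) = 2 * n := by simp [hb]
  have hba : ∀ i, i < 2 * n → b i = a i := fun i hi => by simp [hb, hi.ne]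
  have hcases : ∀ i, i ≤ 2 * n → i ≤ 2 * n - 1 ∨ i = 2 * n := fun i hi => by omega
  refine isCyclicMeander_periodicExtension hn (fun i hi hi' => ?_) (fun i j hi hi' hj hj' h => ?_)
    (fun i hi hi' => ?_) (fun i j hi hi' hj hj' => ?_) (fun i j hi hi1 hi' hj hj1 hj' => ?_)
    (fun i hi hi1 hi' => ?_)
  · rcases hcases i hi' with h | rfl
    · rw [hba i (by omega)]
      have := hrange i hi h
      omega
    · omega
  · rcases hcases i hi' with h1 | rfl <;> rcases hcases j hj' with h2 | rfl
    · rw [hba i (by omega), hba j (by omega)] at h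
      exact hinj i j hi h1 hj h2 h
    · rw [hba i (by omega), hlast] at h
      have := hrange i hi h1
      omega
    · rw [hba j (by omega), hlast] at h
      have := hrange j hj h2
      omega
    · rfl
  · rcases hcases i hi' with h | rfl
    · rw [hba i (by omega)]
      exact hpar i hi h
    · rw [hlast]
  · have hcr : ∀ k, Odd k → k < 2 * n - 1 → ¬ StrictlyBetween (a k) (a (k + 1)) (a (2 * n - 1)) ∧
        a k < 2 * n ∧ a (k + 1) < 2 * n ∧ a k ≠ a (2 * n - 1) ∧ a (k + 1) ≠ a (2 * n - 1) := by
      intro k hk hk'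
      have h1 := hrange k hk.pos hk'.le
      have h2 := hrange (k + 1) (by omega) hk'
      have h3 := hpar (k + 1) (by omega) hk'
      have h4 := hpar (2 * n - 1) (by omega) le_rfl
      rw [Nat.odd_iff] at hk
      refine ⟨hend k (by rwa [Nat.odd_iff]) hk', by omega, by omega, fun h => ?_, by omega⟩
      have := hinj k (2 * n - 1) (by omega) (by omega) (by omega) le_rfl h
      omega
    have hsucc : 2 * n - 1 + 1 = 2 * n := by omega
    have hN := hrange (2 * n - 1) (by omega) le_rfl
    rw [hba i hi', hba j hj']
    rcases hcases (i + 1) hi' with h1 | h1 <;> rcases hcases (j + 1) hj' with h2 | h2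
    · rw [hba _ (by omega), hba _ (by omega)]
      exact hup i j hi (by omega) hj (by omega)
    · obtain rfl : j = 2 * n - 1 := by omega
      have := hcr i hi (by omega)
      rw [hba (i + 1) (by omega), hsucc, hlast]
      simp only [arcsCross_iff, strictlyBetween_iff] at this ⊢
      omega
    · obtain rfl : i = 2 * n - 1 := by omega
      have := hcr j hj (by omega)
      rw [hba (j + 1) (by omega), hsucc, hlast]
      simp only [arcsCross_iff, strictlyBetween_iff] at this ⊢
      omega
    · obtain rfl : i = 2 * n - 1 := by omega
      obtain rfl : j = 2 * n - 1 := by omega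
      exact not_arcsCross_self _ _
  · have h1 : i + 1 < 2 * n := by rw [Nat.even_iff] at hi; omega
    have h2 : j + 1 < 2 * n := by rw [Nat.even_iff] at hj; omega
    rw [hba i hi', hba j hj', hba _ h1, hba _ h2]
    exact hlow i j hi hi1 (by omega) hj hj1 (by omega)
  · have h1 : i + 1 < 2 * n := by rw [Nat.even_iff] at hi; omega
    have h2 := hstart i hi hi1 (by omega)
    have h3 := hrange i hi1 (by omega)
    have h4 := hrange (i + 1) (by omega) (by omega)
    have h5 : a i ≠ a 1 := fun h => by
      have := hinj i 1 hi1 (by omega) le_rfl (by omega) h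
      subst this
      simp at hi
    have h6 : a (i + 1) ≠ a 1 := fun h => by
      have := hinj (i + 1) 1 (by omega) (by omega) le_rfl (by omega) h
      omega
    have h7 := hrange 1 le_rfl (by omega)
    rw [hlast, hba i hi', hba _ h1, hba 1 (by omega)]
    simp only [arcsCross_iff, strictlyBetween_iff] at h2 ⊢
    omega

/-- Cutting a cyclic meander at its rightmost crossing gives an open meander. -/
theorem IsCyclicMeander.isOpenMeandricPerm {n : ℕ} {f : ℤ → ℕ} (hf : IsCyclicMeander n f)
    (hn : 1 ≤ n) (h0 : f 0 = 2 * n) {a : ℕ → ℕ}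
    (ha : ∀ k : ℕ, 1 ≤ k → k ≤ 2 * n - 1 → a k = f k) :
    IsOpenMeandricPerm (2 * n - 1) a := by
  have hs : ∀ k : ℕ, k < 2 * n - 1 → a (k + 1) = f (k + 1) := fun k hk => by
    rw [ha (k + 1) (by omega) (by omega)]
    push_cast
    rfl
  have hlt : ∀ k : ℕ, 1 ≤ k → k ≤ 2 * n - 1 → f k < 2 * n := fun k hk hk' => by
    refine lt_of_le_of_ne (hf.le k) fun h => ?_
    have := hf.eq_of_apply_eq (h.trans h0.symm) (by omega) (by omega)
    omega
  refine ⟨by omega, fun i hi hi' => ?_, fun i j hi hi' hj hj' h => ?_, fun i hi hi' => ?_,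
    fun i j hi hi' hj hj' => ?_, fun i j hi hi1 hi' hj hj1 hj' => ?_, fun i hi hi1 hi' => ?_, ?_⟩
  · have := hlt i hi hi'
    rw [ha i hi hi']
    exact ⟨hf.pos _, by omega⟩
  · rw [ha i hi hi', ha j hj hj'] at h
    have := hf.eq_of_apply_eq h (by omega) (by omega)
    omega
  · have := hf.parity i
    rw [ha i hi hi']
    omega
  · rw [ha i hi.pos hi'.le, ha j hj.pos hj'.le, hs i hi', hs j hj']
    exact hf.upper _ _ (by exact_mod_cast hi) (by exact_mod_cast hj)
  · rw [ha i hi1 hi'.le, ha j hj1 hj'.le, hs i hi', hs j hj']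
    exact hf.lower _ _ (by exact_mod_cast hi) (by exact_mod_cast hj)
  · have h1 := hf.lower i 0 (by exact_mod_cast hi) (by simp)
    have h2 := hf.le i
    have h3 := hf.le (i + 1)
    rw [h0, zero_add] at h1
    rw [ha i hi1 hi'.le, hs i hi', ha 1 le_rfl (by omega), Nat.cast_one]
    simp only [arcsCross_iff, strictlyBetween_iff] at h1 ⊢
    omega
  · rw [if_neg (by rw [Nat.even_iff]; omega)]
    intro i hi hi'
    have h1 := hf.upper i (2 * n - 1 : ℕ) (by exact_mod_cast hi)
      (by rw [Int.odd_iff]; omega)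
    have h2 := hf.le i
    have h3 := hf.le (i + 1)
    have h4 : f ((2 * n - 1 : ℕ) + 1) = 2 * n := by
      rw [← h0]
      exact hf.eq_of_dvd ⟨1, by omega⟩
    rw [h4] at h1
    rw [ha i hi.pos hi'.le, hs i hi', ha (2 * n - 1) (by omega) le_rfl]
    simp only [arcsCross_iff, strictlyBetween_iff] at h1 ⊢
    omega

theorem closedMeanderCount_eq_ncard {n : ℕ} (hn : 1 ≤ n) :
    closedMeanderCount n = {f | IsCyclicMeander n f ∧ f 1 = 1}.ncard := by
  refine Set.ncard_congr (fun a _ => periodicExtension n a) ?_ ?_ ?_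
  · rintro a ⟨ha, -⟩
    refine ⟨ha.isCyclicMeander, ?_⟩
    have := periodicExtension_natCast (n := n) a le_rfl (by omega)
    exact_mod_cast this.trans ha.2.1
  · rintro a b ⟨-, ha⟩ ⟨-, hb⟩ h
    funext i
    by_cases hi : i < 1 ∨ 2 * n < i
    · rw [ha i hi, hb i hi]
    · rw [← periodicExtension_natCast (n := n) a (by omega) (by omega), h,
        periodicExtension_natCast b (by omega) (by omega)]
  · rintro f ⟨hf, h1⟩
    have ha : ∀ k : ℕ, 1 ≤ k → k ≤ 2 * n →
        (fun i : ℕ => if i < 1 ∨ 2 * n < i then 0 else f i) k = f k :=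
      fun k hk hk' => if_neg (by omega)
    exact ⟨_, ⟨hf.isClosedMeandricPerm hn h1 ha, fun i hi => if_pos hi⟩,
      hf.eq_periodicExtension hn ha⟩

theorem openMeanderCount_odd_eq_ncard {n : ℕ} (hn : 1 ≤ n) :
    openMeanderCount (2 * n - 1) = {f | IsCyclicMeander n f ∧ f 0 = 2 * n}.ncard := by
  refine Set.ncard_congr
    (fun a _ => periodicExtension n (Function.update a (2 * n) (2 * n))) ?_ ?_ ?_
  · rintro a ⟨ha, -⟩
    refine ⟨ha.isCyclicMeander hn, ?_⟩
    have := periodicExtension_add_mul (n := n) (Function.update a (2 * n) (2 * n))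
      (k := 2 * n) (by omega) le_rfl (-1)
    simpa using this
  · rintro a b ⟨-, ha⟩ ⟨-, hb⟩ h
    funext i
    by_cases hi : i < 1 ∨ 2 * n - 1 < i
    · rw [ha i hi, hb i hi]
    · have h1 := periodicExtension_natCast (n := n) (Function.update a (2 * n) (2 * n))
        (k := i) (by omega) (by omega)
      have h2 := periodicExtension_natCast (n := n) (Function.update b (2 * n) (2 * n))
        (k := i) (by omega) (by omega)
      rw [Function.update_of_ne (by omega)] at h1 h2
      rw [← h1, ← h2]
      exact congrFun h i
  · rintro f ⟨hf, h0⟩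
    have ha : ∀ k : ℕ, 1 ≤ k → k ≤ 2 * n - 1 →
        (fun i : ℕ => if i < 1 ∨ 2 * n - 1 < i then 0 else f i) k = f k :=
      fun k hk hk' => if_neg (by omega)
    refine ⟨_, ⟨hf.isOpenMeandricPerm hn h0 ha, fun i hi => if_pos hi⟩,
      hf.eq_periodicExtension hn fun k hk hk' => ?_⟩
    by_cases hkn : k = 2 * n
    · subst hkn
      rw [Function.update_self]
      exact h0.symm.trans (hf.eq_of_dvd ⟨-1, by push_cast; ring⟩)
    · rw [Function.update_of_ne hkn]
      exact ha k hk (by omega)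

/-- For every `n ≥ 1`, `M (2n - 1) = M̄ n`. -/
theorem openMeanderCount_odd_eq_closed (n : ℕ) (hn : 1 ≤ n) :
    openMeanderCount (2 * n - 1) = closedMeanderCount n := by
  rw [openMeanderCount_odd_eq_ncard hn, closedMeanderCount_eq_ncard hn]
  exact ncard_isCyclicMeander_eq (by omega) le_rfl le_rfl (by omega) (by simp) (by simp)
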